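/- Let t = (H M₁ … Mₙ) with n ≥ 1, where H is an abstraction or a variable, H is SN and each Mᵢ is SN (for the combined reduction by β, δ, γ and assoc). Assume: (1) if H = λx.N (t is β-head reducible), then M₁ is SN and B[t] = (N[x:=M₁] M₂ … Mₙ) is SN; (2) if H = λx.N and n ≥ 2 (t is γ-head reducible), then C[t] = ((λx.(N M₂)) M₁ M₃ … Mₙ) is SN; (3) if H = λx.λy.N (t is δ-head reducible), then D[t] = ((λy.((λx.N) M₁)) M₂ … Mₙ) is SN; (4) for each i such that Mᵢ is a β-redex, say Mᵢ = ((λx.N) P), the term A[t,i] = ((λx.(H M₁ … Mᵢ₋₁ N)) P Mᵢ₊₁ … Mₙ) is SN. Then t is SN. -/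

import Mathlib

/-- Untyped λ-terms in de Bruijn representation. -/
inductive Lam : Type
  | var : ℕ → Lam
  | lam : Lam → Lam
  | app : Lam → Lam → Lam

namespace Lam

/-- Renaming of de Bruijn indices (extended under binders). -/
def rename (f : ℕ → ℕ) : Lam → Lam
  | var n => var (f n)
  | lam b => lam (rename (fun n => match n with | 0 => 0 | m+1 => f m + 1) b)
  | app a b => app (rename f a) (rename f b)

/-- Shift all free indices up by one. -/
def shift : Lam → Lam := rename Nat.succ

/-- Swap the two innermost free indices. -/
def swap01 : Lam → Lam := rename (fun n => match n with | 0 => 1 | 1 => 0 | m => m)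

/-- Capture-avoiding substitution of `u` for the free variable (index) `k`. -/
def subst : Lam → ℕ → Lam → Lam
  | var n, k, u => if n = k then u else if k < n then var (n-1) else var n
  | lam b, k, u => lam (subst b (k+1) (shift u))
  | app a b, k, u => app (subst a k u) (subst b k u)

/-- The names of the four reduction rules. -/
inductive Rule | beta | delta | gamma | assoc

/-- One-step reduction by a given rule, closed under all term contexts.
β : (λx.M) N ▷ M[x:=N]
δ : (λy.λx.M) N ▷ λx.((λy.M) N)   (x ∉ FV N)
γ : ((λx.M) N) P ▷ (λx.(M P)) N   (x ∉ FV P)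
assoc : M ((λx.N) P) ▷ (λx.(M N)) P   (x ∉ FV M) -/
inductive StepR : Rule → Lam → Lam → Prop
  | beta (M N) : StepR .beta (app (lam M) N) (subst M 0 N)
  | delta (M N) : StepR .delta (app (lam (lam M)) N) (lam (app (lam (swap01 M)) (shift N)))
  | gamma (M N P) : StepR .gamma (app (app (lam M) N) P) (app (lam (app M (shift P))) N)
  | assoc (M N P) : StepR .assoc (app M (app (lam N) P)) (app (lam (app (shift M) N)) P)
  | appL {r M M'} (N) : StepR r M M' → StepR r (app M N) (app M' N)
  | appR {r N N'} (M) : StepR r N N' → StepR r (app M N) (app M N')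
  | under {r M M'} : StepR r M M' → StepR r (lam M) (lam M')

/-- One-step reduction by any of β, δ, γ, assoc. -/
def Step (t t' : Lam) : Prop := ∃ r, StepR r t t'

/-- One-step β-reduction alone. -/
def StepBeta : Lam → Lam → Prop := StepR Rule.beta

/-- `t` is strongly normalizing for the reduction relation `R`:
every `R`-reduction sequence from `t` is finite. -/
def SN (R : Lam → Lam → Prop) (t : Lam) : Prop := Acc (fun a b => R b a) t

/-- Left-nested application `(H M₁ … Mₙ)`. -/
def apps : Lam → List Lam → Lam
  | H, [] => H
  | H, M :: Ms => apps (app H M) Ms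

/-- Types of system 𝒟 : atoms, arrow and intersection. -/
inductive Ty : Type
  | atom : ℕ → Ty
  | arrow : Ty → Ty → Ty
  | inter : Ty → Ty → Ty

/-- Typing judgment of system 𝒟 (contexts are lists of types, de Bruijn style). -/
inductive Typed : List Ty → Lam → Ty → Prop
  | var {Γ n A} : Γ[n]? = some A → Typed Γ (var n) A
  | app {Γ M N A B} : Typed Γ M (.arrow A B) → Typed Γ N A → Typed Γ (app M N) B
  | lam {Γ M A B} : Typed (A :: Γ) M B → Typed Γ (lam M) (.arrow A B)
  | interI {Γ M A B} : Typed Γ M A → Typed Γ M B → Typed Γ M (.inter A B)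
  | interE1 {Γ M A B} : Typed Γ M (.inter A B) → Typed Γ M A
  | interE2 {Γ M A B} : Typed Γ M (.inter A B) → Typed Γ M B

/-- A term is typable in system 𝒟 if it has a type in some context. -/
def Typable (t : Lam) : Prop := ∃ Γ A, Typed Γ t A

end Lam

namespace Lam

/-! ### Simultaneous substitution -/

/-- Extension of a simultaneous substitution under a binder. -/
def up (σ : ℕ → Lam) : ℕ → Lam
  | 0 => var 0
  | n + 1 => shift (σ n)

/-- Simultaneous substitution. -/
def inst (σ : ℕ → Lam) : Lam → Lam
  | var n => σ n
  | lam b => lam (inst (up σ) b)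
  | app a b => app (inst σ a) (inst σ b)

/-- Extension of a renaming under a binder. -/
def upr (f : ℕ → ℕ) : ℕ → ℕ
  | 0 => 0
  | n + 1 => f n + 1

theorem rename_lam (f : ℕ → ℕ) (b : Lam) : rename f (lam b) = lam (rename (upr f) b) := by
  rw [rename]
  congr 2

theorem rename_eq_inst (f : ℕ → ℕ) (t : Lam) : rename f t = inst (fun n => var (f n)) t := by
  induction t generalizing f with
  | var n => rfl
  | app a b iha ihb => simp only [rename, inst, iha, ihb]
  | lam b ih =>
    rw [rename_lam, inst, ih]
    congr 2
    funext n
    cases n <;> rfl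

theorem inst_rename (σ : ℕ → Lam) (f : ℕ → ℕ) (t : Lam) :
    inst σ (rename f t) = inst (fun n => σ (f n)) t := by
  induction t generalizing f σ with
  | var n => rfl
  | app a b iha ihb => simp only [rename, inst, iha, ihb]
  | lam b ih =>
    rw [rename_lam, inst, inst, ih]
    congr 2
    funext n
    cases n <;> rfl

theorem rename_rename (f g : ℕ → ℕ) (t : Lam) :
    rename g (rename f t) = rename (fun n => g (f n)) t := by
  rw [rename_eq_inst g, inst_rename, rename_eq_inst]

theorem rename_upr_shift (f : ℕ → ℕ) (t : Lam) :
    rename (upr f) (shift t) = shift (rename f t) := by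
  simp only [shift, rename_rename]
  rfl

theorem rename_inst (σ : ℕ → Lam) (f : ℕ → ℕ) (t : Lam) :
    rename f (inst σ t) = inst (fun n => rename f (σ n)) t := by
  induction t generalizing f σ with
  | var n => rfl
  | app a b iha ihb => simp only [rename, inst, iha, ihb]
  | lam b ih =>
    rw [inst, rename_lam, inst, ih]
    congr 2
    funext n
    cases n with
    | zero => rfl
    | succ n => exact rename_upr_shift f (σ n)

theorem inst_up_shift (σ : ℕ → Lam) (t : Lam) : inst (up σ) (shift t) = shift (inst σ t) := by
  simp only [shift, inst_rename, rename_inst]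
  rfl

theorem inst_inst (σ τ : ℕ → Lam) (t : Lam) :
    inst τ (inst σ t) = inst (fun n => inst τ (σ n)) t := by
  induction t generalizing σ τ with
  | var n => rfl
  | app a b iha ihb => simp only [inst, iha, ihb]
  | lam b ih =>
    simp only [inst, ih]
    congr 2
    funext n
    cases n with
    | zero => rfl
    | succ n => exact inst_up_shift τ (σ n)

theorem inst_var (t : Lam) : inst var t = t := by
  induction t with
  | var n => rfl
  | app a b iha ihb => simp only [inst, iha, ihb]
  | lam b ih =>
    have h : up var = var := by
      funext n
      cases n <;> rfl
    rw [inst, h, ih]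

/-- The simultaneous substitution performed by `subst`. -/
def single (k : ℕ) (u : Lam) (n : ℕ) : Lam :=
  if n = k then u else if k < n then var (n - 1) else var n

theorem up_single (k : ℕ) (u : Lam) : up (single k u) = single (k + 1) (shift u) := by
  funext n
  cases n with
  | zero => simp [up, single]
  | succ n =>
    simp only [up, single]
    split_ifs <;> first | omega | rfl | (simp only [shift, rename]; congr 1; omega)

theorem subst_eq_inst (t : Lam) (k : ℕ) (u : Lam) : subst t k u = inst (single k u) t := by
  induction t generalizing k u with
  | var n => rfl
  | app a b iha ihb => simp only [subst, inst, iha, ihb]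
  | lam b ih => rw [subst, inst, up_single, ih]

theorem shift_subst (t u : Lam) : (shift t).subst 0 u = t := by
  rw [subst_eq_inst, shift, inst_rename]
  exact inst_var t

theorem inst_subst (σ : ℕ → Lam) (t u : Lam) :
    inst σ (t.subst 0 u) = (inst (up σ) t).subst 0 (inst σ u) := by
  simp only [subst_eq_inst, inst_inst]
  congr 1
  funext n
  cases n with
  | zero => rfl
  | succ n =>
    change σ n = inst (single 0 (inst σ u)) (shift (σ n))
    rw [← subst_eq_inst, shift_subst]

theorem inst_swap01 (σ : ℕ → Lam) (t : Lam) :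
    inst (up (up σ)) (swap01 t) = swap01 (inst (up (up σ)) t) := by
  simp only [swap01, inst_rename, rename_inst]
  congr 1
  funext n
  match n with
  | 0 => rfl
  | 1 => rfl
  | n + 2 =>
    simp only [up, shift, rename_rename]

theorem swap01_subst (t u : Lam) : (swap01 t).subst 0 (shift u) = t.subst 1 (shift u) := by
  simp only [subst_eq_inst, swap01, inst_rename]
  congr 1
  funext n
  match n with
  | 0 => rfl
  | 1 => rfl
  | n + 2 => rfl

theorem subst_one_subst_zero (t u v : Lam) :
    (t.subst 1 (shift v)).subst 0 u = (t.subst 0 (shift u)).subst 0 v := by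
  have h := inst_subst (single 0 v) t (shift u)
  rw [up_single, ← subst_eq_inst, ← subst_eq_inst, ← subst_eq_inst, shift_subst] at h
  exact h.symm

/-! ### Reduction and substitution -/

theorem StepR.inst {r : Rule} {t t' : Lam} (h : StepR r t t') (σ : ℕ → Lam) :
    StepR r (inst σ t) (inst σ t') := by
  induction h generalizing σ with
  | beta M N =>
    rw [inst_subst]
    exact .beta _ _
  | delta M N =>
    simp only [Lam.inst, inst_up_shift, inst_swap01]
    exact .delta _ _
  | gamma M N P =>
    simp only [Lam.inst, inst_up_shift]
    exact .gamma _ _ _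
  | assoc M N P =>
    simp only [Lam.inst, inst_up_shift]
    exact .assoc _ _ _
  | appL N _ ih => exact .appL _ (ih σ)
  | appR M _ ih => exact .appR _ (ih σ)
  | under _ ih => exact .under (ih _)

/-- Many-step reduction. -/
abbrev Steps : Lam → Lam → Prop := Relation.ReflTransGen Step

theorem Steps.appL {a a' : Lam} (h : Steps a a') (b : Lam) : Steps (app a b) (app a' b) :=
  h.lift (fun x => app x b) fun _ _ ⟨r, h⟩ => ⟨r, h.appL b⟩

theorem Steps.appR {b b' : Lam} (a : Lam) (h : Steps b b') : Steps (app a b) (app a b') :=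
  h.lift (app a) fun _ _ ⟨r, h⟩ => ⟨r, h.appR a⟩

theorem Steps.under {b b' : Lam} (h : Steps b b') : Steps (lam b) (lam b') :=
  h.lift lam fun _ _ ⟨r, h⟩ => ⟨r, h.under⟩

theorem Steps.shift {b b' : Lam} (h : Steps b b') : Steps (shift b) (shift b') := by
  refine h.lift Lam.shift ?_
  rintro a b ⟨r, h⟩
  refine ⟨r, ?_⟩
  simpa only [Lam.shift, rename_eq_inst] using h.inst _

theorem steps_inst {σ τ : ℕ → Lam} (h : ∀ n, Steps (σ n) (τ n)) (t : Lam) :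
    Steps (inst σ t) (inst τ t) := by
  induction t generalizing σ τ with
  | var n => exact h n
  | app a b iha ihb => exact ((iha h).appL _).trans ((ihb h).appR _)
  | lam b ih =>
    refine (ih fun n => ?_).under
    cases n with
    | zero => exact .refl
    | succ n => exact (h n).shift

theorem steps_subst {u u' : Lam} (h : Step u u') (t : Lam) :
    Steps (t.subst 0 u) (t.subst 0 u') := by
  rw [subst_eq_inst, subst_eq_inst]
  refine steps_inst (fun n => ?_) t
  cases n with
  | zero => exact .single h
  | succ n => exact .refl

/-! ### Weak head reduction -/

/-- Terms whose head is a variable. -/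
inductive Neutral : Lam → Prop
  | var (n) : Neutral (var n)
  | app {a} (b) : Neutral a → Neutral (app a b)

/-- `WHead t u P`: weak head β-reduction of `t` to `u`, where `P` is the argument of the
contracted redex. -/
inductive WHead : Lam → Lam → Lam → Prop
  | beta (N P) : WHead (app (lam N) P) (N.subst 0 P) P
  | app {a a' P} (b) : WHead a a' P → WHead (app a b) (app a' b) P

theorem WHead.beta' {N P u : Lam} (h : N.subst 0 P = u) : WHead (.app (lam N) P) u P :=
  h ▸ .beta N P

theorem WHead.not_neutral {t u P : Lam} (h : WHead t u P) : ¬ Neutral t := by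
  induction h with
  | beta N P => rintro (_ | ⟨_, h⟩); cases h
  | app b _ ih => rintro (_ | ⟨_, h⟩); exact ih h

theorem WHead.unique {t u P u' P' : Lam} (h : WHead t u P) (h' : WHead t u' P') :
    u = u' ∧ P = P' := by
  induction h generalizing u' with
  | beta N P =>
    cases h' with
    | beta => exact ⟨rfl, rfl⟩
    | app _ h => cases h
  | app b h ih =>
    cases h' with
    | beta => cases h
    | app _ h' =>
      obtain ⟨rfl, rfl⟩ := ih h'
      exact ⟨rfl, rfl⟩

theorem WHead.inst {t u P : Lam} (h : WHead t u P) (σ : ℕ → Lam) :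
    WHead (inst σ t) (inst σ u) (inst σ P) := by
  induction h with
  | beta N P =>
    rw [inst_subst]
    exact .beta _ _
  | app b _ ih => exact .app _ ih

theorem WHead.rename {t u P : Lam} (h : WHead t u P) (f : ℕ → ℕ) :
    WHead (rename f t) (rename f u) (rename f P) := by
  simpa only [rename_eq_inst] using h.inst _

theorem WHead.step {t u P : Lam} (h : WHead t u P) : StepR .beta t u := by
  induction h with
  | beta N P => exact .beta _ _
  | app b _ ih => exact .appL _ ih

theorem Neutral.rename {t : Lam} (h : Neutral t) (f : ℕ → ℕ) : Neutral (rename f t) := by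
  induction h with
  | var n => exact .var _
  | app b _ ih => exact .app _ ih

theorem neutral_or_lam_or_wHead (t : Lam) :
    Neutral t ∨ (∃ b, t = lam b) ∨ ∃ u P, WHead t u P := by
  induction t with
  | var n => exact .inl (.var n)
  | lam b => exact .inr (.inl ⟨b, rfl⟩)
  | app a b iha =>
    rcases iha with h | ⟨c, rfl⟩ | ⟨u, P, h⟩
    · exact .inl (.app b h)
    · exact .inr (.inr ⟨_, _, .beta c b⟩)
    · exact .inr (.inr ⟨_, _, .app b h⟩)

/-- How an arbitrary reduction step interacts with the weak head redex. -/
theorem WHead.step_cases {r : Rule} {t u P t' : Lam} (h : WHead t u P) (hs : StepR r t t') :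
    t' = u ∨
    (∃ u', WHead t' u' P ∧ StepR r u u') ∨
    (r ≠ .beta ∧ WHead t' u P) ∨
    (∃ u' P', WHead t' u' P' ∧ StepR r P P' ∧ Steps u u') ∨
    (r ≠ .beta ∧ ∃ M, t' = lam (.app (lam M) (shift P)) ∧ u = lam (M.subst 0 (shift P))) ∨
    (r ≠ .beta ∧ ∃ Q v w, WHead t' v Q ∧ WHead v w P ∧ WHead u w Q) ∨
    (r ≠ .beta ∧ ∃ Q R v w, P = .app (lam Q) R ∧
      WHead t' v R ∧ WHead v w (Q.subst 0 R) ∧ Steps u w) ∨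
    (r ≠ .beta ∧ ∃ R v w u', Step u u' ∧ WHead t' v R ∧ WHead v w P ∧ WHead u' w R) := by
  induction h generalizing t' with
  | beta N P =>
    cases hs with
    | beta => exact .inl rfl
    | delta M =>
      refine .inr (.inr (.inr (.inr (.inl ⟨nofun, _, rfl, ?_⟩))))
      rw [swap01_subst]
      rfl
    | assoc _ Q R =>
      refine .inr (.inr (.inr (.inr (.inr (.inr (.inl
        ⟨nofun, Q, R, .app (lam N) (Q.subst 0 R), _, rfl, .beta' ?_, .beta _ _, ?_⟩))))))
      · rw [subst, shift_subst]
      · exact steps_subst ⟨_, .beta Q R⟩ N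
    | appL _ h =>
      cases h with
      | under h =>
        refine .inr (.inl ⟨_, .beta _ _, ?_⟩)
        rw [subst_eq_inst, subst_eq_inst]
        exact h.inst _
    | appR _ h =>
      exact .inr (.inr (.inr (.inl ⟨_, _, .beta _ _, h, steps_subst ⟨_, h⟩ N⟩)))
  | @app a a' P b h ih =>
    cases hs with
    | beta => cases h
    | delta => cases h
    | gamma M N _ =>
      cases h with
      | beta =>
        refine .inr (.inr (.inl ⟨nofun, .beta' ?_⟩))
        rw [subst, shift_subst]
      | app _ h => cases h
    | assoc _ Q R =>
      refine .inr (.inr (.inr (.inr (.inr (.inr (.inr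
        ⟨nofun, R, .app a (Q.subst 0 R), .app a' (Q.subst 0 R), _, ⟨_, .assoc a' Q R⟩,
          .beta' ?_, .app _ h, .beta' ?_⟩))))))
      · rw [subst, shift_subst]
      · rw [subst, shift_subst]
    | appR _ hb => exact .inr (.inl ⟨_, .app _ h, .appR _ hb⟩)
    | appL _ ha =>
      rcases ih ha with rfl | ⟨u', h₁, h₂⟩ | ⟨hr, h₁⟩ | ⟨u', P', h₁, h₂, h₃⟩ | ⟨hr, M, rfl, rfl⟩ |
        ⟨hr, Q, v, w, h₁, h₂, h₃⟩ | ⟨hr, Q, R, v, w, rfl, h₁, h₂, h₃⟩ |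
        ⟨hr, R, v, w, u', ⟨s, h₀⟩, h₁, h₂, h₃⟩
      · exact .inl rfl
      · exact .inr (.inl ⟨_, .app _ h₁, .appL _ h₂⟩)
      · exact .inr (.inr (.inl ⟨hr, .app _ h₁⟩))
      · exact .inr (.inr (.inr (.inl ⟨_, _, .app _ h₁, h₂, h₃.appL _⟩)))
      · refine .inr (.inr (.inr (.inr (.inr (.inl
          ⟨hr, b, .app (lam (M.subst 1 (shift b))) P, _, .beta' ?_, .beta _ _, .beta' ?_⟩)))))
        · rw [subst, subst, shift_subst]
        · exact (subst_one_subst_zero _ _ _).symm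
      · exact .inr (.inr (.inr (.inr (.inr (.inl
          ⟨hr, Q, _, _, .app _ h₁, .app _ h₂, .app _ h₃⟩)))))
      · exact .inr (.inr (.inr (.inr (.inr (.inr (.inl
          ⟨hr, Q, R, _, _, rfl, .app _ h₁, .app _ h₂, h₃.appL _⟩))))))
      · exact .inr (.inr (.inr (.inr (.inr (.inr (.inr
          ⟨hr, R, _, _, _, ⟨s, .appL _ h₀⟩, .app _ h₁, .app _ h₂, .app _ h₃⟩))))))

/-! ### A cost decreasing along reduction -/

/-- `Cost k t`: the perpetual evaluation of `t`, which also evaluates every argument consumed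
by a head redex, terminates with cost `k`. -/
inductive Cost : ℕ → Lam → Prop
  | var (n) : Cost 0 (var n)
  | lam {k b} : Cost k b → Cost (k + 1) (lam b)
  | app {i j a b} : Neutral a → Cost i a → Cost j b → Cost (i + j + 1) (app a b)
  | head {i j t u P} : WHead t u P → Cost i P → Cost j u → Cost (i + j + 1) t

theorem Cost.rename {k : ℕ} {t : Lam} (h : Cost k t) (f : ℕ → ℕ) : Cost k (rename f t) := by
  induction h generalizing f with
  | var n => exact .var _
  | lam _ ih =>
    rw [rename_lam]
    exact .lam (ih _)
  | app hn _ _ iha ihb => exact .app (hn.rename f) (iha f) (ihb f)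
  | head hw _ _ ihP ihu => exact .head (hw.rename f) (ihP f) (ihu f)

theorem Cost.head_inv {k : ℕ} {t u P : Lam} (h : Cost k t) (hw : WHead t u P) :
    ∃ i j, Cost i P ∧ Cost j u ∧ k = i + j + 1 := by
  cases h with
  | var => cases hw
  | lam => cases hw
  | app hn _ _ => exact absurd (.app _ hn) hw.not_neutral
  | head hw' hi hj =>
    obtain ⟨rfl, rfl⟩ := hw.unique hw'
    exact ⟨_, _, hi, hj, rfl⟩

theorem Cost.lam_inv {k : ℕ} {b : Lam} (h : Cost k (.lam b)) : ∃ i, Cost i b ∧ k = i + 1 := by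
  cases h with
  | lam h => exact ⟨_, h, rfl⟩
  | head hw => cases hw

theorem Cost.neutral_app_inv {k : ℕ} {a b : Lam} (hn : Neutral a) (h : Cost k (.app a b)) :
    ∃ i j, Cost i a ∧ Cost j b ∧ k = i + j + 1 := by
  cases h with
  | app _ hi hj => exact ⟨_, _, hi, hj, rfl⟩
  | head hw => exact absurd (.app _ hn) hw.not_neutral

/-- Reduction does not increase the cost `k`, and β-reduction decreases it. -/
def StepLowers (k : ℕ) : Prop :=
  ∀ ⦃r t t'⦄, Cost k t → StepR r t t' → ∃ k' ≤ k, Cost k' t' ∧ (r = .beta → k' < k)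

theorem Cost.steps {k : ℕ} (H : ∀ m ≤ k, StepLowers m) {t t' : Lam} (h : Cost k t)
    (hs : Steps t t') : ∃ k' ≤ k, Cost k' t' := by
  induction hs with
  | refl => exact ⟨k, le_rfl, h⟩
  | tail _ hs ih =>
    obtain ⟨m, hm, h⟩ := ih
    obtain ⟨r, hs⟩ := hs
    obtain ⟨k', hk, h', -⟩ := H m hm h hs
    exact ⟨k', hk.trans hm, h'⟩

theorem Neutral.cost_step {r : Rule} {k : ℕ} {t t' : Lam} (hn : Neutral t)
    (H : ∀ m < k, StepLowers m) (h : Cost k t) (hs : StepR r t t') :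
    ∃ k' ≤ k, (r = .beta → k' < k) ∧ ((Neutral t' ∧ Cost k' t') ∨
      ∃ u P i j, WHead t' u P ∧ Neutral u ∧ Cost i P ∧ Cost j u ∧ k' = i + j + 1) := by
  induction hn generalizing k t' with
  | var n => cases hs
  | @app a b hn ih =>
    obtain ⟨i, j, hi, hj, rfl⟩ := h.neutral_app_inv hn
    cases hs with
    | beta => cases hn
    | delta => cases hn
    | gamma => cases hn with | app _ hn => cases hn
    | assoc _ Q R =>
      obtain ⟨x, y, hx, hy, rfl⟩ := hj.head_inv (.beta Q R)
      refine ⟨_, le_rfl, nofun, .inr ⟨.app a (Q.subst 0 R), R, x, i + y + 1, .beta' ?_, .app _ hn,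
        hx, .app hn hi hy, by omega⟩⟩
      rw [subst, shift_subst]
    | appL _ hs =>
      obtain ⟨i', hle, hb, hc⟩ := ih (fun m hm => H m (by omega)) hi hs
      refine ⟨i' + j + 1, by omega, fun e => by have := hb e; omega, ?_⟩
      rcases hc with ⟨hn', hc⟩ | ⟨u, P, x, y, hw, hu, hx, hy, rfl⟩
      · exact .inl ⟨.app _ hn', .app hn' hc hj⟩
      · exact .inr ⟨_, _, x, y + j + 1, .app _ hw, .app _ hu, hx, .app hu hy hj, by omega⟩
    | appR _ hs =>
      obtain ⟨j', hle, hc, hb⟩ := H j (by omega) hj hs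
      exact ⟨i + j' + 1, by omega, fun e => by have := hb e; omega,
        .inl ⟨.app _ hn, .app hn hi hc⟩⟩

theorem stepLowers (k : ℕ) : StepLowers k := by
  induction k using Nat.strong_induction_on with
  | _ k H =>
  intro r t t' h hs
  rcases neutral_or_lam_or_wHead t with hn | ⟨b, rfl⟩ | ⟨u, P, hw⟩
  · obtain ⟨k', hle, hb, ⟨-, hc⟩ | ⟨u, P, i, j, hw, -, hi, hj, rfl⟩⟩ := hn.cost_step H h hs
    · exact ⟨k', hle, hc, hb⟩
    · exact ⟨_, hle, .head hw hi hj, hb⟩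
  · obtain ⟨i, hi, rfl⟩ := h.lam_inv
    cases hs with
    | under hs =>
      obtain ⟨i', hle, hc, hb⟩ := H i (by omega) hi hs
      exact ⟨i' + 1, by omega, .lam hc, fun e => by have := hb e; omega⟩
  · obtain ⟨i, j, hi, hj, rfl⟩ := h.head_inv hw
    rcases hw.step_cases hs with rfl | ⟨u', h₁, h₂⟩ | ⟨hr, h₁⟩ | ⟨u', P', h₁, h₂, h₃⟩ |
        ⟨hr, M, rfl, rfl⟩ | ⟨hr, Q, v, w, h₁, h₂, h₃⟩ | ⟨hr, Q, R, v, w, rfl, h₁, h₂, h₃⟩ |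
        ⟨hr, R, v, w, u', ⟨s, h₀⟩, h₁, h₂, h₃⟩
    · exact ⟨j, by omega, hj, fun _ => by omega⟩
    · obtain ⟨j', hle, hc, hb⟩ := H j (by omega) hj h₂
      exact ⟨i + j' + 1, by omega, .head h₁ hi hc, fun e => by have := hb e; omega⟩
    · exact ⟨_, le_rfl, .head h₁ hi hj, fun e => absurd e hr⟩
    · obtain ⟨i', hle, hc, hb⟩ := H i (by omega) hi h₂
      obtain ⟨j', hle', hc'⟩ := hj.steps (fun m hm => H m (by omega)) h₃
      exact ⟨i' + j' + 1, by omega, .head h₁ hc hc', fun e => by have := hb e; omega⟩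
    · obtain ⟨x, hx, rfl⟩ := hj.lam_inv
      exact ⟨_, le_rfl, .lam (.head (.beta _ _) (hi.rename _) hx), fun e => absurd e hr⟩
    · obtain ⟨x, y, hx, hy, rfl⟩ := hj.head_inv h₃
      exact ⟨x + (i + y + 1) + 1, by omega, .head h₁ hx (.head h₂ hi hy), fun e => absurd e hr⟩
    · obtain ⟨x, y, hx, hy, rfl⟩ := hi.head_inv (.beta Q R)
      obtain ⟨j', hle, hc⟩ := hj.steps (fun m hm => H m (by omega)) h₃
      exact ⟨x + (y + j' + 1) + 1, by omega, .head h₁ hx (.head h₂ hy hc), fun e => absurd e hr⟩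
    · obtain ⟨j', hle, hc, -⟩ := H j (by omega) hj h₀
      obtain ⟨x, y, hx, hy, rfl⟩ := hc.head_inv h₃
      exact ⟨x + (i + y + 1) + 1, by omega, .head h₁ hx (.head h₂ hi hy), fun e => absurd e hr⟩

/-! ### Termination of the permutation rules -/

/-- A weight decreasing along δ, γ and assoc. -/
def weight : Lam → ℕ
  | var _ => 2
  | lam b => weight b + 1
  | app a b => weight a * weight b

theorem two_le_weight (t : Lam) : 2 ≤ weight t := by
  induction t with
  | var n => exact le_rfl
  | lam b ih => exact ih.trans (Nat.le_succ _)
  | app a b iha ihb => exact (by norm_num : 2 ≤ 2 * 2).trans (Nat.mul_le_mul iha ihb)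

theorem weight_rename (f : ℕ → ℕ) (t : Lam) : weight (rename f t) = weight t := by
  induction t generalizing f with
  | var n => rfl
  | lam b ih => rw [rename_lam, weight, weight, ih]
  | app a b iha ihb => rw [rename, weight, weight, iha, ihb]

theorem StepR.weight_lt {r : Rule} {t t' : Lam} (h : StepR r t t') (hr : r ≠ .beta) :
    weight t' < weight t := by
  induction h with
  | beta => exact absurd rfl hr
  | delta M N =>
    have := two_le_weight N
    simp only [weight, swap01, shift, weight_rename]
    nlinarith
  | gamma M N P =>
    have := two_le_weight N
    have := two_le_weight P
    simp only [weight, shift, weight_rename]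
    nlinarith
  | assoc M N P =>
    have := two_le_weight M
    have := two_le_weight P
    simp only [weight, shift, weight_rename]
    nlinarith
  | appL N _ ih =>
    exact Nat.mul_lt_mul_of_pos_right (ih hr) (by have := two_le_weight N; omega)
  | appR M _ ih =>
    exact Nat.mul_lt_mul_of_pos_left (ih hr) (by have := two_le_weight M; omega)
  | under _ ih => exact Nat.succ_lt_succ (ih hr)

/-! ### Cost and strong normalization -/

theorem Cost.sn {k : ℕ} {t : Lam} (h : Cost k t) : SN Step t := by
  induction k using Nat.strong_induction_on generalizing t with
  | _ k ihk =>
  induction hw : weight t using Nat.strong_induction_on generalizing t with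
  | _ w ihw =>
  subst hw
  refine Acc.intro _ ?_
  rintro t' ⟨r, hs⟩
  obtain ⟨k', hle, hc, hb⟩ := stepLowers k h hs
  rcases hle.lt_or_eq with hlt | rfl
  · exact ihk k' hlt hc
  · exact ihw _ (hs.weight_lt fun e => lt_irrefl _ (hb e)) hc rfl

/-- The subterm relation. -/
inductive Subterm : Lam → Lam → Prop
  | refl (t) : Subterm t t
  | lam {s b} : Subterm s b → Subterm s (lam b)
  | appL {s a} (b) : Subterm s a → Subterm s (app a b)
  | appR {s b} (a) : Subterm s b → Subterm s (app a b)

theorem Subterm.trans {s t u : Lam} (h : Subterm s t) (h' : Subterm t u) : Subterm s u := by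
  induction h' with
  | refl => exact h
  | lam _ ih => exact .lam ih
  | appL _ _ ih => exact .appL _ ih
  | appR _ _ ih => exact .appR _ ih

theorem Subterm.step {r : Rule} {s s' t : Lam} (h : Subterm s t) (hs : StepR r s s') :
    ∃ t', StepR r t t' ∧ Subterm s' t' := by
  induction h with
  | refl => exact ⟨_, hs, .refl _⟩
  | lam _ ih =>
    obtain ⟨t', h, h'⟩ := ih
    exact ⟨_, .under h, .lam h'⟩
  | appL _ _ ih =>
    obtain ⟨t', h, h'⟩ := ih
    exact ⟨_, .appL _ h, .appL _ h'⟩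
  | appR _ _ ih =>
    obtain ⟨t', h, h'⟩ := ih
    exact ⟨_, .appR _ h, .appR _ h'⟩

theorem WHead.subterm {t u P : Lam} (h : WHead t u P) : Subterm P t := by
  induction h with
  | beta N P => exact .appR _ (.refl _)
  | app b _ ih => exact .appL _ ih

theorem WHead.sizeOf_lt {t u P : Lam} (h : WHead t u P) : sizeOf P < sizeOf t := by
  induction h with
  | beta N P => simp only [app.sizeOf_spec]; omega
  | app b _ ih => simp only [app.sizeOf_spec]; omega

theorem SN.exists_cost_of_subterm {t : Lam} (h : SN Step t) :
    ∀ s, Subterm s t → ∃ k, Cost k s := by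
  induction h with
  | intro t _ ih =>
  intro s
  induction hn : sizeOf s using Nat.strong_induction_on generalizing s with
  | _ n ihn =>
  subst hn
  intro hst
  rcases neutral_or_lam_or_wHead s with hn | ⟨b, rfl⟩ | ⟨u, P, hw⟩
  · cases hn with
    | var n => exact ⟨_, .var n⟩
    | @app a b hn =>
      obtain ⟨i, hi⟩ := ihn _ (by simp only [app.sizeOf_spec]; omega) a rfl
        ((Subterm.appL b (.refl a)).trans hst)
      obtain ⟨j, hj⟩ := ihn _ (by simp only [app.sizeOf_spec]; omega) b rfl
        ((Subterm.appR a (.refl b)).trans hst)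
      exact ⟨_, .app hn hi hj⟩
  · obtain ⟨i, hi⟩ := ihn _ (by simp only [lam.sizeOf_spec]; omega) b rfl
      ((Subterm.lam (.refl b)).trans hst)
    exact ⟨_, .lam hi⟩
  · obtain ⟨i, hi⟩ := ihn _ hw.sizeOf_lt P rfl (hw.subterm.trans hst)
    obtain ⟨t', ht, hu⟩ := hst.step hw.step
    obtain ⟨j, hj⟩ := ih t' ⟨_, ht⟩ u hu
    exact ⟨_, .head hw hi hj⟩

theorem SN.exists_cost {t : Lam} (h : SN Step t) : ∃ k, Cost k t :=
  h.exists_cost_of_subterm t (.refl t)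

theorem WHead.apps {t u P : Lam} (h : WHead t u P) (Ms : List Lam) :
    WHead (apps t Ms) (apps u Ms) P := by
  induction Ms generalizing t u with
  | nil => exact h
  | cons M Ms ih => exact ih (.app M h)

theorem Neutral.exists_cost_apps {t : Lam} (hn : Neutral t) {k : ℕ} (h : Cost k t)
    (Ms : List Lam) (hMs : ∀ M ∈ Ms, SN Step M) : ∃ k, Cost k (apps t Ms) := by
  induction Ms generalizing t k with
  | nil => exact ⟨k, h⟩
  | cons M Ms ih =>
    obtain ⟨j, hj⟩ := (hMs M List.mem_cons_self).exists_cost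
    exact ih (.app M hn) (.app hn h hj) fun M' h' => hMs M' (List.mem_cons_of_mem _ h')

end Lam

open Lam in
/-- Lemma on head forms. Let `t = (H M₁ … Mₙ)`, `n ≥ 1`, with `H` an
abstraction or a variable, `H` and all `Mᵢ` strongly normalizing. If (1) whenever
`t` is β-head reducible (`H = λx.N`) both `M₁` and `B[t] = (N[x:=M₁] M₂ … Mₙ)` are SN;
(2) whenever `t` is γ-head reducible (`H = λx.N`, `n ≥ 2`),
`C[t] = ((λx.(N M₂)) M₁ M₃ … Mₙ)` is SN; (3) whenever `t` is δ-head reducible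
(`H = λx.λy.N`), `D[t] = ((λy.((λx.N) M₁)) M₂ … Mₙ)` is SN; and (4) for each `i`
with `Mᵢ = ((λx.N) P)` a β-redex,
`A[t,i] = ((λx.(H M₁ … Mᵢ₋₁ N)) P Mᵢ₊₁ … Mₙ)` is SN, then `t` is SN. -/
theorem sn_of_head_conditions
    (H : Lam) (Ms : List Lam) (hn : 1 ≤ Ms.length)
    (hH : (∃ N, H = Lam.lam N) ∨ (∃ k, H = Lam.var k))
    (hHSN : SN Step H) (hMs : ∀ M ∈ Ms, SN Step M)
    (h1 : ∀ N M₁ rest, H = Lam.lam N → Ms = M₁ :: rest →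
      SN Step M₁ ∧ SN Step (apps (N.subst 0 M₁) rest))
    (h2 : ∀ N M₁ M₂ rest, H = Lam.lam N → Ms = M₁ :: M₂ :: rest →
      SN Step (apps (Lam.lam (Lam.app N (shift M₂))) (M₁ :: rest)))
    (h3 : ∀ N M₁ rest, H = Lam.lam (Lam.lam N) → Ms = M₁ :: rest →
      SN Step (apps (Lam.lam (Lam.app (Lam.lam (swap01 N)) (shift M₁))) rest))
    (h4 : ∀ i N P, Ms[i]? = some (Lam.app (Lam.lam N) P) →
      SN Step (apps
        (Lam.app
          (Lam.lam (Lam.app (apps (shift H) ((Ms.take i).map shift)) N)) P)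
        (Ms.drop (i+1)))) :
    SN Step (apps H Ms) := by
  rcases hH with ⟨N, rfl⟩ | ⟨n, rfl⟩
  · match Ms, hn with
    | M₁ :: rest, _ =>
      obtain ⟨hM, hB⟩ := h1 N M₁ rest rfl rfl
      obtain ⟨i, hi⟩ := hM.exists_cost
      obtain ⟨j, hj⟩ := hB.exists_cost
      exact (Cost.head ((WHead.beta N M₁).apps rest) hi hj).sn
  · obtain ⟨k, hk⟩ := (Neutral.var n).exists_cost_apps (.var n) Ms hMs
    exact hk.sn
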